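/- arXiv:1701.02947 — 6 statements merged into one kernel-verified Lean document; each statement's English description precedes it below -/
import Mathlib

section
/- Let A be a non-deterministic Büchi automaton over alphabet T. For every infinite word w ∈ T^ω there exist boxes τ, ρ ∈ Boxes(A) such that w ∈ L(τ)·L(ρ)^ω, i.e. w admits a decomposition w = u⁰u¹u²⋯ into nonempty finite words with ρ_{u⁰} = τ and ρ_{u^j} = ρ for all j ≥ 1. -/
/-- The concatenation `u 0 ++ u 1 ++ u 2 ++ ⋯` of an infinite sequence `u` of finite blocks
is a proper infinite word and equals the infinite word `w`. -/
def OmegaConcat {T : Type*} (u : ℕ → List T) (w : ℕ → T) : Prop :=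
  (∀ n : ℕ, ∃ j : ℕ, n < (((List.range j).map u).flatten).length) ∧
  (∀ j n : ℕ, n < (((List.range j).map u).flatten).length →
    (((List.range j).map u).flatten)[n]? = some (w n))

/-- `V·U^ω`: the set of infinite words `v u₁ u₂ u₃ ⋯` with `v ∈ V` and each `u_j ∈ U`. -/
def ProdOmega {T : Type*} (V U : Set (List T)) : Set (ℕ → T) :=
  { w | ∃ u : ℕ → List T, u 0 ∈ V ∧ (∀ j, 1 ≤ j → u j ∈ U) ∧ OmegaConcat u w }

/-- A non-deterministic Büchi automaton with state type `Q` over alphabet `T`. -/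
structure NBA (T : Type*) (Q : Type*) where
  /-- initial state -/
  start : Q
  /-- set of final (accepting) states -/
  final : Set Q
  /-- transition relation -/
  step : Q → T → Q → Prop

namespace NBA

variable {T Q : Type*}

/-- `A.Reach q u q'`: there is a `u`-labelled run from `q` to `q'` (written `q →^u q'`). -/
inductive Reach (A : NBA T Q) : Q → List T → Q → Prop
  | refl (q : Q) : Reach A q [] q
  | step {q q' q'' : Q} {a : T} {u : List T} :
      A.step q a q' → Reach A q' u q'' → Reach A q (a :: u) q''

/-- `A.ReachF q u q'`: there is a `u`-labelled run from `q` to `q'` visiting a final state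
(including the endpoints), written `q →^u_f q'`. -/
def ReachF (A : NBA T Q) (q : Q) (u : List T) (q' : Q) : Prop :=
  ∃ u₁ u₂ qf, u = u₁ ++ u₂ ∧ qf ∈ A.final ∧ A.Reach q u₁ qf ∧ A.Reach qf u₂ q'

/-- The box `ρ_u` of a finite word `u`: it contains `(q, q', 1)` iff `q →^u_f q'` and
`(q, q', 0)` iff `q →^u q'` but not `q →^u_f q'`. -/
def boxOf (A : NBA T Q) (u : List T) : Set (Q × Q × Bool) :=
  { x | (x.2.2 = true ∧ A.ReachF x.1 u x.2.1) ∨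
        (x.2.2 = false ∧ A.Reach x.1 u x.2.1 ∧ ¬ A.ReachF x.1 u x.2.1) }

/-- The language `L(ρ)` of a box: all nonempty finite words whose box is `ρ`. -/
def boxLang (A : NBA T Q) (ρ : Set (Q × Q × Bool)) : Set (List T) :=
  { u | u ≠ [] ∧ A.boxOf u = ρ }

/-- `L^ω(A)`: infinite words admitting a run from the initial state that visits final states
infinitely often. -/
def omegaLang (A : NBA T Q) : Set (ℕ → T) :=
  { w | ∃ r : ℕ → Q, r 0 = A.start ∧ (∀ n, A.step (r n) (w n) (r (n + 1))) ∧
        ∀ n, ∃ m, n ≤ m ∧ r m ∈ A.final }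

end NBA

/-- A box over state set `Q`: no pair `(q, q')` carries both flags. -/
def IsBox {Q : Type*} (ρ : Set (Q × Q × Bool)) : Prop :=
  ∀ q q' : Q, ¬ ((q, q', true) ∈ ρ ∧ (q, q', false) ∈ ρ)

/-- Composition of boxes. -/
def boxComp {Q : Type*} (ρ σ : Set (Q × Q × Bool)) : Set (Q × Q × Bool) :=
  { x | (x.2.2 = true ∧
          ∃ q'' b c, (x.1, q'', b) ∈ ρ ∧ (q'', x.2.1, c) ∈ σ ∧ (b || c) = true) ∨
        (x.2.2 = false ∧
          (∃ q'', (x.1, q'', false) ∈ ρ ∧ (q'', x.2.1, false) ∈ σ) ∧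
          ¬ ∃ q'' b c, (x.1, q'', b) ∈ ρ ∧ (q'', x.2.1, c) ∈ σ ∧ (b || c) = true) }

/-- **Infinite Ramsey theorem** for pairs of natural numbers and finitely many colours. -/
theorem exists_strictMono_monochromatic {κ : Type*} [Finite κ] (c : ℕ → ℕ → κ) :
    ∃ (C : κ) (f : ℕ → ℕ), StrictMono f ∧ ∀ m n, m < n → c (f m) (f n) = C := by
  have key (g : ℕ → κ) : ∃ k, ∀ᶠ n in (Filter.hyperfilter ℕ : Filter ℕ), g n = k := by
    obtain ⟨k, hk⟩ := ((Filter.hyperfilter ℕ).map g).eq_pure_of_finite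
    refine ⟨k, ?_⟩
    have : ({k} : Set κ) ∈ (Filter.hyperfilter ℕ).map g := by
      rw [hk]
      exact Set.mem_singleton k
    exact this
  choose d hd using fun i => key (c i)
  obtain ⟨C, hC⟩ := key d
  obtain ⟨f, -, hf⟩ := exists_seq_of_forall_finset_exists (fun i => d i = C)
    (fun i j => i < j ∧ c i j = C) fun s hs => by
      have h : ∀ᶠ j in (Filter.hyperfilter ℕ : Filter ℕ), ∀ i ∈ s, i < j ∧ c i j = C := by
        refine (Filter.eventually_all_finset s).2 fun i hi => ?_
        have hlt : ∀ᶠ j in (Filter.hyperfilter ℕ : Filter ℕ), i < j :=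
          Nat.hyperfilter_le_atTop (Filter.eventually_gt_atTop i)
        filter_upwards [hlt, hd i] with j hij hj
        exact ⟨hij, hj.trans (hs i hi)⟩
      exact (hC.and h).exists
  exact ⟨C, f, fun m n h => (hf m n h).1, fun m n h => (hf m n h).2⟩

theorem flatten_map_Ico {T : Type*} (w : ℕ → T) {g : ℕ → ℕ} (hg : Monotone g) (j : ℕ) :
    ((List.range j).map fun i => (List.Ico (g i) (g (i + 1))).map w).flatten =
      (List.Ico (g 0) (g j)).map w := by
  induction j with
  | zero => simp
  | succ j ih =>
    rw [List.range_succ, List.map_append, List.flatten_append, ih, List.map_singleton,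
      List.flatten_singleton, ← List.map_append,
      List.Ico.append_consecutive (hg (Nat.zero_le j)) (hg j.le_succ)]

/-- Cutting `w` at the positions of a strictly increasing sequence starting at `0`
decomposes `w`. -/
theorem omegaConcat_Ico {T : Type*} (w : ℕ → T) {g : ℕ → ℕ} (hg : StrictMono g)
    (h0 : g 0 = 0) : OmegaConcat (fun i => (List.Ico (g i) (g (i + 1))).map w) w := by
  simp only [OmegaConcat, flatten_map_Ico w hg.monotone, h0, List.length_map, List.Ico.length]
  refine ⟨fun n => ⟨n + 1, ?_⟩, fun j n hn => ?_⟩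
  · have := hg.le_apply (x := n + 1)
    omega
  · rw [List.Ico.zero_bot, List.getElem?_map, List.getElem?_range (by simpa using hn)]
    rfl

theorem NBA.isBox_boxOf {T Q : Type*} (A : NBA T Q) (u : List T) : IsBox (A.boxOf u) := by
  rintro q q' ⟨h₁, h₂⟩
  simp_all [NBA.boxOf]

/-- every infinite word lies in `L(τ)·L(ρ)^ω` for some boxes `τ, ρ`. -/
theorem exists_boxes_decomposition {T Q : Type} [Finite T] [Finite Q]
    (A : NBA T Q) (w : ℕ → T) :
    ∃ τ ρ : Set (Q × Q × Bool), IsBox τ ∧ IsBox ρ ∧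
      ∃ u : ℕ → List T, (∀ j, u j ≠ []) ∧ A.boxOf (u 0) = τ ∧
        (∀ j, 1 ≤ j → A.boxOf (u j) = ρ) ∧ OmegaConcat u w := by
  obtain ⟨ρ, f, hf, hρ⟩ :=
    exists_strictMono_monochromatic fun i j => A.boxOf ((List.Ico i j).map w)
  have hpos (n : ℕ) : 0 < f (n + 1) := (Nat.zero_le _).trans_lt (hf n.lt_succ_self)
  let g : ℕ → ℕ := fun n => n.casesOn 0 fun k => f (k + 1)
  have hg : StrictMono g := strictMono_nat_of_lt_succ fun n => by
    cases n with
    | zero => exact hpos 0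
    | succ n => exact hf (Nat.lt_succ_self _)
  have hu : ∀ j, 1 ≤ j → A.boxOf ((List.Ico (g j) (g (j + 1))).map w) = ρ := by
    rintro (_ | j) hj
    · omega
    · exact hρ _ _ (Nat.lt_succ_self _)
  refine ⟨_, ρ, A.isBox_boxOf _, hu 1 le_rfl ▸ A.isBox_boxOf _,
    fun i => (List.Ico (g i) (g (i + 1))).map w, fun j => ?_, rfl, hu, omegaConcat_Ico w hg rfl⟩
  simpa [List.Ico.eq_empty_iff] using hg j.lt_succ_self
end

section
/- Let A be a non-deterministic Büchi automaton over alphabet T and let τ, ρ ∈ Boxes(A). Then either L(τ)·L(ρ)^ω ⊆ L^ω(A), or L(τ)·L(ρ)^ω is disjoint from L^ω(A). -/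
namespace NBA

variable {T Q : Type*} {A : NBA T Q}

/-- `f` lists the states of a run of `A` over the finite word `v`. -/
def IsPath (A : NBA T Q) (f : ℕ → Q) (v : List T) : Prop :=
  ∀ i a, v[i]? = some a → A.step (f i) a (f (i + 1))

theorem Reach.append {p q r : Q} {u v : List T} (h : A.Reach p u q) (h' : A.Reach q v r) :
    A.Reach p (u ++ v) r := by
  induction h with
  | refl q => exact h'
  | step hs _ ih => exact .step hs (ih h')

theorem ReachF.reach {p q : Q} {u : List T} (h : A.ReachF p u q) : A.Reach p u q := by
  obtain ⟨u₁, u₂, qf, rfl, -, h₁, h₂⟩ := h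
  exact h₁.append h₂

theorem IsPath.reach {f : ℕ → Q} {v : List T} (h : A.IsPath f v) :
    A.Reach (f 0) v (f v.length) := by
  induction v generalizing f with
  | nil => exact .refl _
  | cons a v ih =>
    exact .step (h 0 a rfl) (ih (f := fun i => f (i + 1)) fun i b hb => h (i + 1) b (by simpa using hb))

theorem IsPath.reachF {f : ℕ → Q} {v : List T} (h : A.IsPath f v) {k : ℕ} (hk : k ≤ v.length)
    (hf : f k ∈ A.final) : A.ReachF (f 0) v (f v.length) := by
  refine ⟨v.take k, v.drop k, f k, (List.take_append_drop k v).symm, hf, ?_, ?_⟩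
  · have h₁ : A.IsPath f (v.take k) := fun i a ha => h i a (by
      rw [List.getElem?_take] at ha
      split_ifs at ha with hi
      exact ha)
    simpa [hk] using h₁.reach
  · have h₂ : A.IsPath (fun i => f (k + i)) (v.drop k) := fun i a ha => h (k + i) a (by
      rwa [List.getElem?_drop] at ha)
    simpa [hk] using h₂.reach

theorem Reach.exists_isPath_append {p q : Q} {u v : List T} (h : A.Reach p u q) {g : ℕ → Q}
    (hg : g 0 = q) (hp : A.IsPath g v) :
    ∃ f : ℕ → Q, f 0 = p ∧ (∀ i, f (u.length + i) = g i) ∧ A.IsPath f (u ++ v) := by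
  induction h with
  | refl q => exact ⟨g, hg, by simp, hp⟩
  | @step p p' q a u hs _ ih =>
    obtain ⟨f, h0, hi, hf⟩ := ih hg
    refine ⟨fun n => Nat.casesOn n p f, rfl, fun i => ?_, ?_⟩
    · rw [List.length_cons, Nat.add_right_comm]
      exact hi i
    · rintro (_ | i) b hb
      · obtain rfl : a = b := by simpa using hb
        simpa [h0] using hs
      · exact hf i b (by simpa using hb)

theorem Reach.exists_isPath {p q : Q} {u : List T} (h : A.Reach p u q) :
    ∃ f : ℕ → Q, f 0 = p ∧ f u.length = q ∧ A.IsPath f u := by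
  obtain ⟨f, h0, hi, hf⟩ := h.exists_isPath_append (g := fun _ => q) (v := []) rfl
    (fun i a ha => by simp at ha)
  exact ⟨f, h0, hi 0, by simpa using hf⟩

theorem ReachF.exists_isPath {p q : Q} {u : List T} (h : A.ReachF p u q) :
    ∃ f : ℕ → Q, f 0 = p ∧ f u.length = q ∧ A.IsPath f u ∧ ∃ k ≤ u.length, f k ∈ A.final := by
  obtain ⟨u₁, u₂, qf, rfl, hqf, h₁, h₂⟩ := h
  obtain ⟨g, hg0, hg1, hg⟩ := h₂.exists_isPath
  obtain ⟨f, h0, hi, hf⟩ := h₁.exists_isPath_append hg0 hg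
  refine ⟨f, h0, by rw [List.length_append, hi, hg1], hf, u₁.length, by simp, ?_⟩
  have := hi 0
  rw [add_zero, hg0] at this
  rwa [this]

theorem reachF_iff_of_boxOf_eq {u v : List T} (h : A.boxOf u = A.boxOf v) (p q : Q) :
    A.ReachF p u q ↔ A.ReachF p v q := by
  simpa [boxOf] using Set.ext_iff.mp h (p, q, true)

theorem reach_iff_of_boxOf_eq {u v : List T} (h : A.boxOf u = A.boxOf v) (p q : Q) :
    A.Reach p u q ↔ A.Reach p v q := by
  have h₁ := reachF_iff_of_boxOf_eq h p q
  have h₀ : A.Reach p u q ∧ ¬ A.ReachF p u q ↔ A.Reach p v q ∧ ¬ A.ReachF p v q := by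
    simpa [boxOf] using Set.ext_iff.mp h (p, q, false)
  have hu := ReachF.reach (A := A) (p := p) (q := q) (u := u)
  have hv := ReachF.reach (A := A) (p := p) (q := q) (u := v)
  tauto

end NBA

/-- The position at which the block `u j` starts in `u 0 ++ u 1 ++ ⋯`. -/
def blockStart {T : Type*} (u : ℕ → List T) (j : ℕ) : ℕ :=
  (((List.range j).map u).flatten).length

section Blocks

variable {T Q : Type*} {u v : ℕ → List T} {w x : ℕ → T}

theorem blockStart_zero (u : ℕ → List T) : blockStart u 0 = 0 := rfl

theorem blockStart_succ (u : ℕ → List T) (j : ℕ) :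
    blockStart u (j + 1) = blockStart u j + (u j).length := by
  simp only [blockStart, List.range_succ, List.map_append, List.flatten_append, List.length_append]
  simp

theorem blockStart_strictMono (hu : ∀ j, u j ≠ []) : StrictMono (blockStart u) :=
  strictMono_nat_of_lt_succ fun j => by
    have := List.length_pos_iff.mpr (hu j)
    rw [blockStart_succ]
    omega

theorem exists_block (hu : ∀ j, u j ≠ []) (n : ℕ) :
    ∃ j, blockStart u j ≤ n ∧ n < blockStart u (j + 1) := by
  induction n with
  | zero =>
    refine ⟨0, le_rfl, ?_⟩
    exact blockStart_strictMono hu Nat.zero_lt_one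
  | succ n ih =>
    obtain ⟨j, h₁, h₂⟩ := ih
    by_cases h : n + 1 < blockStart u (j + 1)
    · exact ⟨j, by omega, h⟩
    · have := blockStart_strictMono hu (Nat.lt_succ_self (j + 1))
      exact ⟨j + 1, by omega, by simp only [Nat.succ_eq_add_one] at this; omega⟩

theorem block_unique (hu : ∀ j, u j ≠ []) {n i j : ℕ} (hi : blockStart u i ≤ n)
    (hi' : n < blockStart u (i + 1)) (hj : blockStart u j ≤ n)
    (hj' : n < blockStart u (j + 1)) : i = j := by
  have h₁ := (blockStart_strictMono hu).lt_iff_lt.mp (hi.trans_lt hj')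
  have h₂ := (blockStart_strictMono hu).lt_iff_lt.mp (hj.trans_lt hi')
  omega

theorem OmegaConcat.getElem?_block (h : OmegaConcat u w) {i j : ℕ} (hi : i < (u j).length) :
    (u j)[i]? = some (w (blockStart u j + i)) := by
  have := h.2 (j + 1) (blockStart u j + i) (by
    change _ < blockStart u (j + 1)
    rw [blockStart_succ]
    omega)
  rw [List.range_succ, List.map_append, List.flatten_append, blockStart,
    List.getElem?_append_right (Nat.le_add_right _ _)] at this
  simpa [blockStart] using this

theorem NBA.mem_omegaLang_of_blocks {A : NBA T Q} (hu : ∀ j, u j ≠ []) (h : OmegaConcat u w)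
    {s : ℕ → Q} (h0 : s 0 = A.start) (hs : ∀ j, A.Reach (s j) (u j) (s (j + 1)))
    (hF : ∀ n, ∃ j, n ≤ j ∧ A.ReachF (s j) (u j) (s (j + 1))) : w ∈ A.omegaLang := by
  have hpath : ∀ j, ∃ f : ℕ → Q, f 0 = s j ∧ f (u j).length = s (j + 1) ∧ A.IsPath f (u j) ∧
      (A.ReachF (s j) (u j) (s (j + 1)) → ∃ k ≤ (u j).length, f k ∈ A.final) := by
    intro j
    by_cases hj : A.ReachF (s j) (u j) (s (j + 1))
    · obtain ⟨f, h₁, h₂, h₃, h₄⟩ := hj.exists_isPath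
      exact ⟨f, h₁, h₂, h₃, fun _ => h₄⟩
    · obtain ⟨f, h₁, h₂, h₃⟩ := (hs j).exists_isPath
      exact ⟨f, h₁, h₂, h₃, fun h => absurd h hj⟩
  choose f hf0 hf1 hf hfF using hpath
  choose J hJ hJ' using exists_block hu
  let r : ℕ → Q := fun n => f (J n) (n - blockStart u (J n))
  have hlt : ∀ j i, i < (u j).length → r (blockStart u j + i) = f j i := by
    intro j i hi
    have : J (blockStart u j + i) = j :=
      block_unique hu (hJ _) (hJ' _) (Nat.le_add_right _ _) (by rw [blockStart_succ]; omega)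
    simp [r, this]
  have hr : ∀ j i, i ≤ (u j).length → r (blockStart u j + i) = f j i := by
    intro j i hi
    rcases hi.lt_or_eq with hi | rfl
    · exact hlt j i hi
    · have := hlt (j + 1) 0 (List.length_pos_iff.mpr (hu _))
      rwa [add_zero, blockStart_succ, hf0, ← hf1 j] at this
  refine ⟨r, ?_, fun n => ?_, fun n => ?_⟩
  · have := hr 0 0 (Nat.zero_le _)
    rwa [blockStart_zero, hf0, h0] at this
  · obtain ⟨j, h₁, h₂⟩ := exists_block hu n
    obtain ⟨i, rfl⟩ := Nat.exists_eq_add_of_le h₁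
    have hi : i < (u j).length := by rw [blockStart_succ] at h₂; omega
    rw [add_assoc, hr j i hi.le, hr j (i + 1) hi]
    exact hf j i _ (h.getElem?_block hi)
  · obtain ⟨j, hj, hjF⟩ := hF n
    obtain ⟨k, hk, hkF⟩ := hfF j hjF
    refine ⟨blockStart u j + k, ?_, by rwa [hr j k hk]⟩
    have := (blockStart_strictMono hu).le_apply (x := j)
    omega

theorem NBA.exists_blocks_of_mem_omegaLang {A : NBA T Q} (hu : ∀ j, u j ≠ [])
    (h : OmegaConcat u w) (hw : w ∈ A.omegaLang) :
    ∃ s : ℕ → Q, s 0 = A.start ∧ (∀ j, A.Reach (s j) (u j) (s (j + 1))) ∧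
      ∀ n, ∃ j, n ≤ j ∧ A.ReachF (s j) (u j) (s (j + 1)) := by
  obtain ⟨r, h0, hr, hF⟩ := hw
  have hpath : ∀ j, A.IsPath (fun i => r (blockStart u j + i)) (u j) := by
    intro j i a ha
    have hi : i < (u j).length := (List.getElem?_eq_some_iff.mp ha).1
    obtain rfl : w (blockStart u j + i) = a := by
      rw [h.getElem?_block hi] at ha
      exact Option.some.inj ha
    exact hr _
  refine ⟨fun j => r (blockStart u j), h0, fun j => ?_, fun n => ?_⟩
  · simpa [blockStart_succ] using (hpath j).reach
  · obtain ⟨m, hm, hmF⟩ := hF (blockStart u n)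
    obtain ⟨j, h₁, h₂⟩ := exists_block hu m
    have hnj := (blockStart_strictMono hu).lt_iff_lt.mp (hm.trans_lt h₂)
    obtain ⟨i, rfl⟩ := Nat.exists_eq_add_of_le h₁
    have hi : i ≤ (u j).length := by rw [blockStart_succ] at h₂; omega
    exact ⟨j, by omega, by simpa [blockStart_succ] using (hpath j).reachF hi hmF⟩

theorem NBA.mem_omegaLang_of_boxOf_eq {A : NBA T Q} (hu : ∀ j, u j ≠ []) (hv : ∀ j, v j ≠ [])
    (huv : ∀ j, A.boxOf (u j) = A.boxOf (v j)) (hw : OmegaConcat u w) (hx : OmegaConcat v x)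
    (hA : w ∈ A.omegaLang) : x ∈ A.omegaLang := by
  obtain ⟨s, h0, hs, hF⟩ := exists_blocks_of_mem_omegaLang hu hw hA
  refine mem_omegaLang_of_blocks hv hx h0
    (fun j => (reach_iff_of_boxOf_eq (huv j) _ _).mp (hs j)) fun n => ?_
  obtain ⟨j, hj, hjF⟩ := hF n
  exact ⟨j, hj, (reachF_iff_of_boxOf_eq (huv j) _ _).mp hjF⟩

end Blocks

/-- `L(τ)·L(ρ)^ω` is either contained in `L^ω(A)` or disjoint from it. -/
theorem boxLang_prodOmega_subset_or_disjoint {T Q : Type} [Finite T] [Finite Q]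
    (A : NBA T Q) (τ ρ : Set (Q × Q × Bool)) (hτ : IsBox τ) (hρ : IsBox ρ) :
    ProdOmega (A.boxLang τ) (A.boxLang ρ) ⊆ A.omegaLang ∨
      Disjoint (ProdOmega (A.boxLang τ) (A.boxLang ρ)) A.omegaLang := by
  rw [or_iff_not_imp_right, Set.not_disjoint_iff]
  rintro ⟨w, ⟨u, hu0, hu, huw⟩, hwA⟩ x ⟨v, hv0, hv, hvx⟩
  have hmem : ∀ j, ∃ σ, u j ∈ A.boxLang σ ∧ v j ∈ A.boxLang σ := by
    rintro (_ | j)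
    · exact ⟨τ, hu0, hv0⟩
    · exact ⟨ρ, hu _ (Nat.le_add_left 1 j), hv _ (Nat.le_add_left 1 j)⟩
  choose σ hσu hσv using hmem
  exact NBA.mem_omegaLang_of_boxOf_eq (fun j => (hσu j).1) (fun j => (hσv j).1)
    (fun j => (hσu j).2.trans (hσv j).2.symm) huw hvx hwA
end

section
/- Let F and G be negation-free CNF formulas over a set At of atomic propositions, represented as finite sets of clauses (each clause a finite subset of At). Then F entails G if and only if there is a map j : G → F on clauses such that j(H) ⊆ H for every clause H ∈ G. -/
/-- A truth assignment satisfies a negation-free CNF formula (a finite set of clauses, each a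
finite set of atoms) if every clause contains an atom mapped to `true`. -/
def CNFSat {At : Type*} (ν : At → Bool) (F : Finset (Finset At)) : Prop :=
  ∀ K ∈ F, ∃ a ∈ K, ν a = true

/-- `F` entails `G`: every assignment satisfying `F` satisfies `G`. -/
def CNFEntails {At : Type*} (F G : Finset (Finset At)) : Prop :=
  ∀ ν : At → Bool, CNFSat ν F → CNFSat ν G

/-- `F` entails `G` iff there is a map `j` from clauses of `G` to clauses of `F`
with `j(H) ⊆ H` for every clause `H ∈ G`. -/
theorem cnfEntails_iff_exists_clause_map {At : Type} (F G : Finset (Finset At)) :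
    CNFEntails F G ↔ ∃ j : Finset At → Finset At, ∀ H ∈ G, j H ∈ F ∧ j H ⊆ H := by
  classical
  constructor
  · intro h
    have key : ∀ H ∈ G, ∃ K ∈ F, K ⊆ H := by
      intro H hH
      by_contra! hF
      have hsat : CNFSat (fun a => decide (a ∉ H)) F := fun K hK => by
        simpa using Finset.not_subset.mp (hF K hK)
      obtain ⟨a, ha, hν⟩ := h _ hsat H hH
      exact of_decide_eq_true hν ha
    choose! j hj using key
    exact ⟨j, hj⟩
  · rintro ⟨j, hj⟩ ν hν H hH
    obtain ⟨a, ha, hνa⟩ := hν (j H) (hj H hH).1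
    exact ⟨a, (hj H hH).2 ha, hνa⟩
end

section
/- Let F and G be negation-free CNF formulas over a set At of atomic propositions such that F entails G. Then for every choice function c on F there exists a choice function c' on G that refines c, i.e. {c'(H) : H ∈ G} ⊆ {c(K) : K ∈ F}. -/
/-- if `F` entails `G`, every choice function on `F` can be refined to a choice
function on `G` whose image is contained in the image of the given one. -/
theorem exists_refining_choice_function {At : Type} (F G : Finset (Finset At))
    (hent : CNFEntails F G)
    (c : ∀ K ∈ F, At) (hc : ∀ K (hK : K ∈ F), c K hK ∈ K) :
    ∃ c' : ∀ H ∈ G, At,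
      (∀ H (hH : H ∈ G), c' H hH ∈ H) ∧
      (∀ H (hH : H ∈ G), ∃ K, ∃ hK : K ∈ F, c' H hH = c K hK) := by
  classical
  have hG : CNFSat (fun a => decide (∃ K, ∃ hK : K ∈ F, a = c K hK)) G :=
    hent _ fun K hK => ⟨c K hK, hc K hK, decide_eq_true ⟨K, hK, rfl⟩⟩
  choose c' hmem himage using hG
  exact ⟨c', hmem, fun H hH => of_decide_eq_true (himage H hH)⟩
end

section
/- The relation ⪡ on finite sequences of natural numbers is well-founded, and its minimal elements are exactly the sequences all of whose entries are 0. -/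
/-- The ordering `v ⪡ w` on finite sequences of natural numbers: `w = x·⟨i⟩·z` with `i > 0`
and `v = x·y·z` where every entry of `y` is strictly smaller than `i`. -/
def SeqLT (v w : List ℕ) : Prop :=
  ∃ (x y z : List ℕ) (i : ℕ), 0 < i ∧ (∀ a ∈ y, a < i) ∧
    v = x ++ y ++ z ∧ w = x ++ [i] ++ z

theorem SeqLT.cutExpand {v w : List ℕ} (h : SeqLT v w) :
    Relation.CutExpand (· < ·) (v : Multiset ℕ) (w : Multiset ℕ) := by
  obtain ⟨x, y, z, i, -, hy, rfl, rfl⟩ := h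
  refine ⟨(y : Multiset ℕ), i, by simpa using hy, ?_⟩
  simp only [← Multiset.coe_add, Multiset.coe_singleton]
  abel

theorem seqLT_wellFounded : WellFounded SeqLT :=
  Subrelation.wf (fun h => h.cutExpand)
    (InvImage.wf (fun l : List ℕ => (l : Multiset ℕ)) (wellFounded_lt (α := ℕ)).cutExpand)

theorem exists_seqLT_iff {w : List ℕ} : (∃ v, SeqLT v w) ↔ ∃ a ∈ w, 0 < a := by
  constructor
  · rintro ⟨v, x, y, z, i, hi, -, -, rfl⟩
    exact ⟨i, by simp, hi⟩
  · rintro ⟨a, ha, hpos⟩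
    obtain ⟨x, z, rfl⟩ := List.append_of_mem ha
    exact ⟨x ++ [] ++ z, x, [], z, a, hpos, by simp, rfl, by simp⟩

/-- `⪡` is well-founded and its minimal elements are exactly the all-zero
sequences. -/
theorem seqLT_wellFounded_and_minimal :
    WellFounded SeqLT ∧
    ∀ w : List ℕ, (¬ ∃ v : List ℕ, SeqLT v w) ↔ (∀ a ∈ w, a = 0) := by
  refine ⟨seqLT_wellFounded, fun w => ?_⟩
  rw [exists_seqLT_iff]
  simp
end

section
/- For every deadlock-free parity game P = (V = V_□ ⊎ V_○, E, Ω) on a finite directed graph, there is a partition of the vertices V = W_□ ⊎ W_○ and there are positional strategies s_□ : V_□ → V and s_○ : V_○ → V such that s_□ is winning for player □ from every vertex in W_□ and s_○ is winning for player ○ from every vertex in W_○. -/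
/-- `k` occurs infinitely often in the sequence `f`. -/
def InfOcc (f : ℕ → ℕ) (k : ℕ) : Prop := ∀ n, ∃ m, n ≤ m ∧ f m = k

/-- A parity game on vertex type `V`: an ownership partition (we use `true` for player □ and
`false` for player ○), an edge relation, and a priority function. -/
structure ParityGame (V : Type*) where
  /-- `owner v = true` iff `v` is owned by player □. -/
  owner : V → Bool
  /-- edge relation of the game graph -/
  edge : V → V → Prop
  /-- priority function -/
  prio : V → ℕ

namespace ParityGame

variable {V : Type*}

/-- An infinite play starting in `v`. -/
def IsPlay (G : ParityGame V) (v : V) (f : ℕ → V) : Prop :=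
  f 0 = v ∧ ∀ n, G.edge (f n) (f (n + 1))

/-- The play conforms to the positional strategy `s` of the player owning vertices with
ownership flag `b`. -/
def Conforms (G : ParityGame V) (b : Bool) (s : V → V) (f : ℕ → V) : Prop :=
  ∀ n, G.owner (f n) = b → f (n + 1) = s (f n)

/-- The play is won by player □: the highest priority occurring infinitely often is even. -/
def WonBySquare (G : ParityGame V) (f : ℕ → V) : Prop :=
  ∃ k, Even k ∧ InfOcc (fun n => G.prio (f n)) k ∧
    ∀ k', InfOcc (fun n => G.prio (f n)) k' → k' ≤ k

end ParityGame

namespace ParityGame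

variable {V : Type*}

/-- The play is won by player `b`: the highest priority occurring infinitely often has the
parity of `b`. -/
def WonBy (G : ParityGame V) (b : Bool) (f : ℕ → V) : Prop :=
  ∃ k, decide (Even k) = b ∧ InfOcc (fun n => G.prio (f n)) k ∧
    ∀ k', InfOcc (fun n => G.prio (f n)) k' → k' ≤ k

/-- Every vertex of `U` has a successor in `U`. -/
def IsArena (G : ParityGame V) (U : Set V) : Prop :=
  ∀ v ∈ U, ∃ w ∈ U, G.edge v w

/-- In the subgame on `U`, player `b` can confine the play to `W` and wins it there, by means of
the positional strategy `s`. -/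
structure IsDominion (G : ParityGame V) (U : Set V) (b : Bool) (s : V → V) (W : Set V) :
    Prop where
  subset : W ⊆ U
  own : ∀ v ∈ W, G.owner v = b → s v ∈ W
  opp : ∀ v ∈ W, G.owner v ≠ b → ∀ w ∈ U, G.edge v w → w ∈ W
  win : ∀ f : ℕ → V, (∀ n, f n ∈ W) → (∀ n, G.edge (f n) (f (n + 1))) →
    G.Conforms b s f → G.WonBy b f

/-- In the subgame on `U`, player `b` can force the play from `A` into `T` by means of the
positional strategy `s`, as witnessed by the rank function `r`. -/
structure Attracts (G : ParityGame V) (U T : Set V) (b : Bool) (s : V → V) (r : V → ℕ)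
    (A : Set V) : Prop where
  target_subset : T ⊆ A
  subset : A ⊆ U
  own : ∀ v ∈ A, v ∉ T → s v ∈ A ∧ G.edge v (s v) ∧ r (s v) < r v
  opp : ∀ v ∈ A, v ∉ T → G.owner v ≠ b → ∀ w ∈ U, G.edge v w → w ∈ A ∧ r w < r v

variable {G : ParityGame V} {U T A W : Set V} {b : Bool} {s : V → V} {r : V → ℕ} {f : ℕ → V}

theorem WonBy.not_wonBySquare (h : G.WonBy false f) : ¬ G.WonBySquare f := by
  rintro ⟨k, hk, hinf, hmax⟩
  obtain ⟨l, hl, hinf', hmax'⟩ := h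
  obtain rfl : k = l := le_antisymm (hmax' k hinf) (hmax l hinf')
  simp [hk] at hl

theorem WonBy.wonBySquare (h : G.WonBy true f) : G.WonBySquare f := by
  obtain ⟨k, hk, h⟩ := h
  exact ⟨k, of_decide_eq_true hk, h⟩

theorem WonBy.of_tail (m : ℕ) (h : G.WonBy b fun n => f (m + n)) : G.WonBy b f := by
  have key : ∀ k, InfOcc (fun n => G.prio (f (m + n))) k ↔ InfOcc (fun n => G.prio (f n)) k := by
    refine fun k => ⟨fun h n => ?_, fun h n => ?_⟩
    · obtain ⟨i, hi, rfl⟩ := h n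
      exact ⟨m + i, by omega, rfl⟩
    · obtain ⟨i, hi, rfl⟩ := h (m + n)
      exact ⟨i - m, by omega, by simp [Nat.add_sub_cancel' (show m ≤ i by omega)]⟩
  simpa only [WonBy, key] using h

/-- A play that stays in the subgame and enters a dominion while following its strategy there
is won. -/
theorem IsDominion.wonBy_of_mem (h : G.IsDominion U b s W) (hU : ∀ n, f n ∈ U)
    (he : ∀ n, G.edge (f n) (f (n + 1)))
    (hc : ∀ n, f n ∈ W → G.owner (f n) = b → f (n + 1) = s (f n)) {m : ℕ} (hm : f m ∈ W) :
    G.WonBy b f := by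
  have hW : ∀ n, f (m + n) ∈ W := by
    intro n
    induction n with
    | zero => exact hm
    | succ n ih =>
      by_cases ho : G.owner (f (m + n)) = b
      · rw [← add_assoc, hc _ ih ho]
        exact h.own _ ih ho
      · exact h.opp _ ih ho _ (hU _) (he _)
  exact .of_tail m (h.win _ hW (fun n => he _) fun n => hc _ (hW n))

theorem Attracts.exists_mem_target (h : G.Attracts U T b s r A) (hU : ∀ n, f n ∈ U)
    (he : ∀ n, G.edge (f n) (f (n + 1)))
    (hc : ∀ n, f n ∈ A → f n ∉ T → G.owner (f n) = b → f (n + 1) = s (f n))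
    {m : ℕ} (hm : f m ∈ A) : ∃ n, m ≤ n ∧ f n ∈ T := by
  induction hr : r (f m) using Nat.strong_induction_on generalizing m with
  | _ k ih =>
    subst hr
    by_cases hT : f m ∈ T
    · exact ⟨m, le_rfl, hT⟩
    have hstep : f (m + 1) ∈ A ∧ r (f (m + 1)) < r (f m) := by
      by_cases ho : G.owner (f m) = b
      · rw [hc m hm hT ho]
        exact ⟨(h.own _ hm hT).1, (h.own _ hm hT).2.2⟩
      · exact h.opp _ hm hT ho _ (hU _) (he m)
    obtain ⟨n, hn, hnT⟩ := ih _ hstep.2 hstep.1 rfl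
    exact ⟨n, by omega, hnT⟩

/-- A set that attracts to `T` extends by any vertex from which player `b` can force the play
into it. -/
theorem Attracts.insert [Finite V] (h : G.Attracts U T b s r A) {v w : V} (hv : v ∈ U)
    (hvA : v ∉ A) (hw : w ∈ A) (hvw : G.edge v w)
    (hopp : G.owner v ≠ b → ∀ u ∈ U, G.edge v u → u ∈ A) :
    ∃ s' r', G.Attracts U T b s' r' (insert v A) := by
  classical
  obtain ⟨M, hM⟩ := (Set.finite_range r).bddAbove
  have hM : ∀ u, r u < M + 1 := fun u => Nat.lt_succ_of_le (hM ⟨u, rfl⟩)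
  have hne : ∀ u ∈ A, u ≠ v := fun u hu huv => hvA (huv ▸ hu)
  refine ⟨Function.update s v w, Function.update r v (M + 1),
    h.target_subset.trans (Set.subset_insert _ _), Set.insert_subset hv h.subset, ?_, ?_⟩
  · rintro u (rfl | hu) hT
    · simp [hw, hvw, hne w hw, hM]
    · obtain ⟨h1, h2, h3⟩ := h.own u hu hT
      simp [hne u hu, hne _ h1, h1, h2, h3]
  · rintro u (rfl | hu) hT ho x hx hux
    · have := hopp ho x hx hux
      simp [this, hne x this, hM]
    · obtain ⟨h1, h2⟩ := h.opp u hu hT ho x hx hux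
      simp [hne u hu, hne _ h1, h1, h2]

/-- Attractors exist: their complement is an arena which player `b` cannot leave. -/
theorem exists_attracts [Finite V] (hU : G.IsArena U) (hT : T ⊆ U) (b : Bool) :
    ∃ s r A, G.Attracts U T b s r A ∧ G.IsArena (U \ A) ∧
      ∀ v ∈ U \ A, G.owner v = b → ∀ w ∈ A, ¬ G.edge v w := by
  obtain ⟨A, ⟨s, r, h⟩, hmax⟩ :=
    (Set.toFinite {A : Set V | ∃ s r, G.Attracts U T b s r A}).exists_maximal
      ⟨T, id, fun _ => 0, subset_rfl, hT, fun v hv hv' => absurd hv hv',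
        fun v hv hv' => absurd hv hv'⟩
  have key : ∀ v ∈ U \ A, ∀ w ∈ A, G.edge v w →
      ¬ (G.owner v ≠ b → ∀ u ∈ U, G.edge v u → u ∈ A) := fun v hv w hw hvw hopp =>
    hv.2 (hmax (h.insert hv.1 hv.2 hw hvw hopp) (Set.subset_insert v A) (Set.mem_insert v A))
  refine ⟨s, r, A, h, fun v hv => ?_,
    fun v hv ho w hw hvw => key v hv w hw hvw fun h => absurd ho h⟩
  by_contra! hcon
  have hsucc : ∀ u ∈ U, G.edge v u → u ∈ A := fun u hu hvu =>
    by_contra fun huA => hcon u ⟨hu, huA⟩ hvu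
  obtain ⟨w, hw, hvw⟩ := hU v hv.1
  exact key v hv w (hsucc w hw hvw) hvw fun _ => hsucc

/-- The strategy that follows `s₁` on `T`, `s₂` on the rest of `A`, and `s₃` elsewhere. -/
noncomputable def mixStrategy (T A : Set V) (s₁ s₂ s₃ : V → V) : V → V :=
  open Classical in T.piecewise s₁ (A.piecewise s₂ s₃)

section mixStrategy

variable {s₁ s₂ s₃ : V → V} {v : V}

theorem mixStrategy_of_mem (h : v ∈ T) : mixStrategy T A s₁ s₂ s₃ v = s₁ v := by
  simp [mixStrategy, h]

theorem mixStrategy_of_mem_of_notMem (h : v ∈ A) (hT : v ∉ T) :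
    mixStrategy T A s₁ s₂ s₃ v = s₂ v := by
  simp [mixStrategy, h, hT]

theorem mixStrategy_of_notMem (hTA : T ⊆ A) (h : v ∉ A) :
    mixStrategy T A s₁ s₂ s₃ v = s₃ v := by
  have hT : v ∉ T := fun hT => h (hTA hT)
  simp [mixStrategy, h, hT]

/-- Mixing strategies that move along edges inside `U` yields such a strategy. -/
theorem Attracts.mixStrategy_mem (h : G.Attracts U T b s r A)
    (h₁ : ∀ v ∈ T, s₁ v ∈ U ∧ G.edge v (s₁ v))
    (h₃ : ∀ v ∈ U \ A, s₃ v ∈ U \ A ∧ G.edge v (s₃ v)) (hv : v ∈ U) :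
    mixStrategy T A s₁ s s₃ v ∈ U ∧ G.edge v (mixStrategy T A s₁ s s₃ v) := by
  by_cases hT : v ∈ T
  · rw [mixStrategy_of_mem hT]
    exact h₁ v hT
  by_cases hA : v ∈ A
  · rw [mixStrategy_of_mem_of_notMem hA hT]
    exact ⟨h.subset (h.own v hA hT).1, (h.own v hA hT).2.1⟩
  · rw [mixStrategy_of_notMem h.target_subset hA]
    exact ⟨(h₃ v ⟨hv, hA⟩).1.1, (h₃ v ⟨hv, hA⟩).2⟩

/-- If player `b` attracts `A` to the vertices of maximal priority, which has the parity of `b`,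
and wins everywhere outside `A`, then player `b` wins everywhere. -/
theorem Attracts.isDominion_univ {d : ℕ} (hd : ∀ v ∈ U, G.prio v ≤ d)
    (h : G.Attracts U {v ∈ U | G.prio v = d} (decide (Even d)) s r A)
    (h₁ : ∀ v ∈ U, s₁ v ∈ U ∧ G.edge v (s₁ v))
    (h₃ : ∀ v ∈ U \ A, s₃ v ∈ U \ A ∧ G.edge v (s₃ v))
    (hdom : G.IsDominion (U \ A) (decide (Even d)) s₃ (U \ A)) :
    G.IsDominion U (decide (Even d)) (mixStrategy {v ∈ U | G.prio v = d} A s₁ s s₃) U := by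
  refine ⟨subset_rfl, fun v hv _ => (h.mixStrategy_mem (fun v hv => h₁ v hv.1) h₃ hv).1,
    fun v _ _ w hw _ => hw, fun f hf he hc => ?_⟩
  by_cases hev : ∃ m, ∀ n, m ≤ n → f n ∉ A
  · obtain ⟨m, hm⟩ := hev
    refine .of_tail m (hdom.win _ (fun n => ⟨hf _, hm _ (by omega)⟩) (fun n => he _) ?_)
    intro n ho
    have := hc _ ho
    rwa [mixStrategy_of_notMem h.target_subset (hm _ (by omega))] at this
  · push Not at hev
    refine ⟨d, rfl, fun n => ?_, fun k hk => ?_⟩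
    · obtain ⟨m, hm, hmA⟩ := hev n
      obtain ⟨i, hi, hiT⟩ := h.exists_mem_target hf he (fun n hA hT ho => by
        rw [hc n ho, mixStrategy_of_mem_of_notMem hA hT]) hmA
      exact ⟨i, by omega, hiT.2⟩
    · obtain ⟨m, -, rfl⟩ := hk 0
      exact hd _ (hf m)

/-- An attractor of a dominion of player `b`, together with a dominion of player `b` in the
remaining arena, is a dominion. -/
theorem Attracts.isDominion_union (h : G.Attracts U T b s r A) (hT : G.IsDominion U b s₁ T)
    (hW : G.IsDominion (U \ A) b s₃ W) :
    G.IsDominion U b (mixStrategy T A s₁ s s₃) (A ∪ W) := by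
  refine ⟨Set.union_subset h.subset (hW.subset.trans Set.sdiff_subset), ?_, ?_, ?_⟩
  · intro v hv ho
    by_cases hvT : v ∈ T
    · rw [mixStrategy_of_mem hvT]
      exact .inl (h.target_subset (hT.own v hvT ho))
    by_cases hvA : v ∈ A
    · rw [mixStrategy_of_mem_of_notMem hvA hvT]
      exact .inl (h.own v hvA hvT).1
    · rw [mixStrategy_of_notMem h.target_subset hvA]
      exact .inr (hW.own v (hv.resolve_left hvA) ho)
  · intro v hv ho w hw hvw
    by_cases hvT : v ∈ T
    · exact .inl (h.target_subset (hT.opp v hvT ho w hw hvw))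
    by_cases hvA : v ∈ A
    · exact .inl (h.opp v hvA hvT ho w hw hvw).1
    by_cases hwA : w ∈ A
    · exact .inl hwA
    · exact .inr (hW.opp v (hv.resolve_left hvA) ho w ⟨hw, hwA⟩ hvw)
  · intro f hf he hc
    have hU : ∀ n, f n ∈ U := fun n =>
      (hf n).elim (fun hA => h.subset hA) fun hA => (hW.subset hA).1
    by_cases hex : ∃ m, f m ∈ A
    · obtain ⟨m, hm⟩ := hex
      obtain ⟨n, -, hn⟩ := h.exists_mem_target hU he (fun n hA hT ho => by
        rw [hc n ho, mixStrategy_of_mem_of_notMem hA hT]) hm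
      exact hT.wonBy_of_mem hU he (fun n hT ho => by rw [hc n ho, mixStrategy_of_mem hT]) hn
    · push Not at hex
      exact hW.win f (fun n => (hf n).resolve_left (hex n)) he fun n ho => by
        rw [hc n ho, mixStrategy_of_notMem h.target_subset (hex n)]

/-- A dominion of the opponent of `b` in the complement of a set `A` which player `b` cannot
enter from outside is a dominion in the whole arena. -/
theorem IsDominion.of_diff (h : G.IsDominion (U \ A) (!b) s W)
    (hA : ∀ v ∈ U \ A, G.owner v = b → ∀ w ∈ A, ¬ G.edge v w) :
    G.IsDominion U (!b) s W :=
  ⟨h.subset.trans Set.sdiff_subset, h.own, fun v hv ho w hw hvw =>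
    h.opp v hv ho w ⟨hw, fun hwA => hA v (h.subset hv) (by simpa using ho) w hwA hvw⟩ hvw, h.win⟩

theorem IsDominion.congr {s' : V → V} (h : G.IsDominion U b s W) (hs : ∀ v ∈ W, s' v = s v) :
    G.IsDominion U b s' W :=
  ⟨h.subset, fun v hv ho => hs v hv ▸ h.own v hv ho, h.opp, fun f hf he hc =>
    h.win f hf he fun n ho => (hc n ho).trans (hs _ (hf n))⟩

theorem isDominion_empty : G.IsDominion U b s ∅ :=
  ⟨Set.empty_subset _, fun _ h => h.elim, fun _ h => h.elim, fun _ h => (h 0).elim⟩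

end mixStrategy

/-- Every arena is covered by dominions of the two players, with a common strategy function. -/
theorem IsArena.exists_isDominion [Finite V] (hU : G.IsArena U) :
    ∃ (s : V → V) (W : Bool → Set V), (∀ v ∈ U, s v ∈ U ∧ G.edge v (s v)) ∧
      (∀ v ∈ U, ∃ b, v ∈ W b) ∧ ∀ b, G.IsDominion U b s (W b) := by
  induction U using WellFoundedLT.induction with
  | _ U ih =>
    have hlt : ∀ {T A : Set V}, T ⊆ A → A ⊆ U → T.Nonempty → U \ A < U :=
      fun hTA hAU ⟨v, hv⟩ =>
        Set.ssubset_iff_of_subset Set.sdiff_subset |>.2 ⟨v, hAU (hTA hv), fun h => h.2 (hTA hv)⟩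
    rcases U.eq_empty_or_nonempty with rfl | hne
    · exact ⟨id, fun _ => ∅, by simp, by simp, fun b => isDominion_empty⟩
    have hsucc : ∀ v ∈ U, ∃ w, w ∈ U ∧ G.edge v w := hU
    obtain ⟨v₀, hv₀, hmax⟩ := U.toFinite.exists_maximalFor G.prio U hne
    have hd : ∀ v ∈ U, G.prio v ≤ G.prio v₀ := fun v hv =>
      (le_total (G.prio v) (G.prio v₀)).elim id (hmax hv)
    have : Nonempty V := ⟨v₀⟩
    choose! e he using hsucc
    obtain ⟨d, hdv⟩ : ∃ d, d = G.prio v₀ := ⟨_, rfl⟩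
    rw [← hdv] at hd
    have hN : {v ∈ U | G.prio v = d} ⊆ U := fun v hv => hv.1
    obtain ⟨sA, rA, A, hA, hUA, hleave⟩ := exists_attracts hU hN (decide (Even d))
    obtain ⟨s₁, W₁, hs₁, hcov₁, hW₁⟩ :=
      ih (U \ A) (hlt hA.target_subset hA.subset ⟨v₀, hv₀, hdv.symm⟩) hUA
    obtain ⟨b, hb⟩ : ∃ b, b = decide (Even d) := ⟨_, rfl⟩
    rcases (W₁ !b).eq_empty_or_nonempty with hempty | hne₁
    · have hWb : W₁ b = U \ A := by
        refine (hW₁ b).subset.antisymm fun v hv => ?_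
        obtain ⟨c, hc⟩ := hcov₁ v hv
        rcases Bool.eq_or_eq_not c b with rfl | rfl
        · exact hc
        · simp [hempty] at hc
      have hdom := hW₁ b
      rw [hWb, hb] at hdom
      refine ⟨mixStrategy {v ∈ U | G.prio v = d} A e sA s₁, fun c => {v ∈ U | c = b},
        fun v hv => hA.mixStrategy_mem (fun v hv => he v hv.1) hs₁ hv,
        fun v hv => ⟨b, hv, rfl⟩, fun c => ?_⟩
      by_cases hc : c = b
      · simpa [hc, hb] using hA.isDominion_univ hd he hs₁ hdom
      · simpa [hc] using isDominion_empty
    · rw [← hb] at hleave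
      have hT := (hW₁ !b).of_diff hleave
      obtain ⟨sB, rB, B, hB, hUB, hleave'⟩ := exists_attracts hU hT.subset (!b)
      obtain ⟨s₂, W₂, hs₂, hcov₂, hW₂⟩ :=
        ih (U \ B) (hlt hB.target_subset hB.subset hne₁) hUB
      refine ⟨mixStrategy (W₁ !b) B s₁ sB s₂, fun c => if c = b then W₂ b else B ∪ W₂ !b,
        fun v hv => hB.mixStrategy_mem (fun v hv => ?_) hs₂ hv, fun v hv => ?_, fun c => ?_⟩
      · have := hs₁ v ((hW₁ !b).subset hv)
        exact ⟨this.1.1, this.2⟩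
      · by_cases hvB : v ∈ B
        · exact ⟨!b, by simp [hvB]⟩
        obtain ⟨c, hc⟩ := hcov₂ v ⟨hv, hvB⟩
        rcases Bool.eq_or_eq_not c b with rfl | rfl
        · exact ⟨c, by simp [hc]⟩
        · exact ⟨!b, by simp [hc]⟩
      · rcases Bool.eq_or_eq_not c b with rfl | rfl
        · have h₂ : G.IsDominion (U \ B) (!!c) s₂ (W₂ c) := by simpa using hW₂ c
          simpa using (h₂.of_diff hleave').congr fun v hv =>
            mixStrategy_of_notMem hB.target_subset (h₂.subset hv).2
        · simpa using hB.isDominion_union hT (hW₂ !b)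

end ParityGame

/-- positional determinacy of parity games: in every deadlock-free finite
parity game the vertex set partitions into winning regions `W_□` and `W_○ = V \ W_□` with
corresponding positional winning strategies. -/
theorem parityGame_positional_determinacy {V : Type} [Finite V]
    (G : ParityGame V) (hdf : ∀ v : V, ∃ v', G.edge v v') :
    ∃ (Wsq : Set V) (ssq sci : V → V),
      (∀ v : V, G.owner v = true → G.edge v (ssq v)) ∧
      (∀ v : V, G.owner v = false → G.edge v (sci v)) ∧
      (∀ v ∈ Wsq, ∀ f : ℕ → V,
        G.IsPlay v f → G.Conforms true ssq f → G.WonBySquare f) ∧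
      (∀ v ∉ Wsq, ∀ f : ℕ → V,
        G.IsPlay v f → G.Conforms false sci f → ¬ G.WonBySquare f) := by
  obtain ⟨s, W, hs, hcov, hW⟩ := ParityGame.IsArena.exists_isDominion (G := G) (U := Set.univ)
    fun v _ => (hdf v).imp fun w hw => ⟨Set.mem_univ w, hw⟩
  have hwin : ∀ b, ∀ v ∈ W b, ∀ f, G.IsPlay v f → G.Conforms b s f → G.WonBy b f :=
    fun b v hv f hf hc => (hW b).wonBy_of_mem (fun _ => Set.mem_univ _) hf.2
      (fun n _ => hc n) (m := 0) (hf.1 ▸ hv)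
  refine ⟨W true, s, s, fun v _ => (hs v trivial).2, fun v _ => (hs v trivial).2,
    fun v hv f hf hc => (hwin true v hv f hf hc).wonBySquare, fun v hv f hf hc => ?_⟩
  obtain ⟨_ | _, hb⟩ := hcov v trivial
  · exact (hwin false v hb f hf hc).not_wonBySquare
  · exact absurd hb hv
end
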